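/- arXiv:2105.07765 — 2 statements merged into one kernel-verified Lean document; each statement's English description precedes it below -/
import Mathlib

section
/- Let s* be a global minimizer over ℝ^n of m(s) = f₀ + ⟨g,s⟩ + (1/2)⟨Hs,s⟩ + (σ/6) N(s)³, and let u be an eigenvector of H associated with the smallest eigenvalue λ_min[H], with ‖u‖₂ = 1 and N(u) ≤ 1, whose sign is chosen so that ⟨g + Hs*, u⟩ ≤ 0. Then λ_min[H] + ω(s*) σ N(s*) ≥ 0, where ω(s) := 1 + (2/√3)√ψ(s) for s ≠ 0 with ψ(s) := max[0, 1 + 2⟨g + Hs, u⟩/(σ N(s)²)], and ω(0) := 1. -/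
open scoped RealInnerProductSpace Classical

noncomputable section

/-- Abbreviation for the Euclidean space `ℝ^n`. -/
abbrev E (n : ℕ) := EuclideanSpace ℝ (Fin n)

/-- `N` is a norm on `ℝ^n` (possibly non-smooth, e.g. `ℓ¹` or `ℓ∞`). -/
structure IsNorm (n : ℕ) (N : E n → ℝ) : Prop where
  add_le : ∀ x y, N (x + y) ≤ N x + N y
  smul : ∀ (c : ℝ) (x : E n), N (c • x) = |c| * N x
  eq_zero : ∀ x, N x = 0 → x = 0

/-- The dual norm `‖v‖_{N,1} := max_{N s = 1} ⟪v, s⟫`. -/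
def dualNorm (n : ℕ) (N : E n → ℝ) (v : E n) : ℝ :=
  sSup {t : ℝ | ∃ s, N s = 1 ∧ t = ⟪v, s⟫}

/-- The smallest eigenvalue of a symmetric operator `A`, as the infimum of the
Rayleigh quotient over the Euclidean unit sphere. -/
def lamMin (n : ℕ) (A : E n →L[ℝ] E n) : ℝ :=
  sInf {t : ℝ | ∃ v : E n, ‖v‖ = 1 ∧ t = ⟪A v, v⟫}

/-- The norm `‖H‖_{N,2} := max_{N s = 1} |⟪H s, s⟫|` of a symmetric operator induced by `N`. -/
def matNormN (n : ℕ) (N : E n → ℝ) (A : E n →L[ℝ] E n) : ℝ :=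
  sSup {t : ℝ | ∃ v : E n, N v = 1 ∧ t = |⟪A v, v⟫|}

/-- The regularized quadratic model
`m(s) = f₀ + ⟪g,s⟫ + (1/2)⟪Hs,s⟫ + (σ/6) N(s)³`. -/
def qm (n : ℕ) (N : E n → ℝ) (f0 : ℝ) (g : E n) (H : E n →L[ℝ] E n) (σ : ℝ)
    (s : E n) : ℝ :=
  f0 + ⟪g, s⟫ + (1 / 2) * ⟪H s, s⟫ + σ / 6 * N s ^ 3

theorem IsNorm.nonneg {n : ℕ} {N : E n → ℝ} (hN : IsNorm n N) (x : E n) : 0 ≤ N x := by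
  have h := hN.add_le x ((-1 : ℝ) • x)
  have h0 := hN.smul 0 (0 : E n)
  rw [hN.smul] at h
  simp only [neg_smul, one_smul, add_neg_cancel, abs_neg, abs_one, one_mul] at h
  simp only [smul_zero, abs_zero, zero_mul] at h0
  linarith

/-- Change of the model along a ray in an eigendirection of `H` on which `N` is at most `1`. -/
theorem qm_add_smul_le {n : ℕ} {N : E n → ℝ} (hN : IsNorm n N) (f0 : ℝ) (g : E n)
    {H : E n →L[ℝ] E n} (hH : ∀ x y : E n, ⟪H x, y⟫ = ⟪x, H y⟫) {σ : ℝ} (hσ : 0 < σ)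
    (s : E n) {u : E n} {l : ℝ} (hu : H u = l • u) (hu2 : ‖u‖ = 1) (huN : N u ≤ 1)
    {t : ℝ} (ht : 0 ≤ t) :
    qm n N f0 g H σ (s + t • u) ≤ qm n N f0 g H σ s + t * ⟪g + H s, u⟫ + t ^ 2 * l / 2
      + σ / 6 * ((N s + t) ^ 3 - N s ^ 3) := by
  have hle : N (s + t • u) ≤ N s + t := by
    have h := hN.add_le s (t • u)
    rw [hN.smul, abs_of_nonneg ht] at h
    nlinarith
  have hcube : σ / 6 * N (s + t • u) ^ 3 ≤ σ / 6 * (N s + t) ^ 3 := by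
    have h0 := hN.nonneg (s + t • u)
    gcongr
  have huu : ⟪u, u⟫ = (1 : ℝ) := by rw [real_inner_self_eq_norm_sq, hu2, one_pow]
  have hus : ⟪l • u, s⟫ = ⟪H s, u⟫ := by rw [← hu, hH, real_inner_comm]
  have hquad : ⟪H (s + t • u), s + t • u⟫ = ⟪H s, s⟫ + 2 * t * ⟪H s, u⟫ + t ^ 2 * l := by
    rw [map_add, map_smul, hu]
    simp only [inner_add_left, inner_add_right, real_inner_smul_left, real_inner_smul_right,
      huu] at hus ⊢
    linear_combination t * hus
  unfold qm
  rw [hquad, inner_add_right, real_inner_smul_right, inner_add_left]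
  linarith

/-- If `a + b t + c t²` is nonnegative for all `t > 0`, then `b ≥ -2 √(a c)`. -/
theorem neg_two_mul_sqrt_le_of_forall_pos {a b c : ℝ} (hc : 0 < c)
    (h : ∀ t : ℝ, 0 < t → 0 ≤ a + b * t + c * t ^ 2) : -(2 * √(a * c)) ≤ b := by
  rcases le_or_gt 0 b with hb | hb
  · linarith [Real.sqrt_nonneg (a * c)]
  · have ht := h (-b / (2 * c)) (div_pos (by linarith) (by linarith))
    have heq : a + b * (-b / (2 * c)) + c * (-b / (2 * c)) ^ 2 = (a * c - (-b / 2) ^ 2) / c := by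
      field_simp
      ring
    rw [heq, le_div_iff₀ hc, zero_mul, sub_nonneg] at ht
    linarith [Real.le_sqrt_of_sq_le ht]

/-- second-order necessary condition for a global minimizer of the
regularized quadratic: `λ_min[H] + ω(s*) σ N(s*) ≥ 0`. -/
theorem stmt11 {n : ℕ} (hn : 1 ≤ n) (N : E n → ℝ) (hN : IsNorm n N)
    (f0 : ℝ) (g : E n) (H : E n →L[ℝ] E n)
    (hH : ∀ x y : E n, ⟪H x, y⟫ = ⟪x, H y⟫)
    (σ : ℝ) (hσ : 0 < σ) (sstar : E n)
    (hmin : ∀ t, qm n N f0 g H σ sstar ≤ qm n N f0 g H σ t)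
    (u : E n) (hu : H u = lamMin n H • u) (hu2 : ‖u‖ = 1) (huN : N u ≤ 1)
    (hsign : ⟪g + H sstar, u⟫ ≤ 0) :
    0 ≤ lamMin n H +
        (if sstar = 0 then 1
          else 1 + 2 / Real.sqrt 3 *
            Real.sqrt (max 0 (1 + 2 * ⟪g + H sstar, u⟫ / (σ * N sstar ^ 2)))) *
          σ * N sstar := by
  have hpos : ∀ t : ℝ, 0 < t → 0 ≤ (⟪g + H sstar, u⟫ + σ * N sstar ^ 2 / 2)
      + (lamMin n H + σ * N sstar) / 2 * t + σ / 6 * t ^ 2 := by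
    intro t ht
    have h := (hmin _).trans (qm_add_smul_le hN f0 g hH hσ sstar hu hu2 huN ht.le)
    refine nonneg_of_mul_nonneg_right ?_ ht
    linarith
  have hbound := neg_two_mul_sqrt_le_of_forall_pos (by positivity) hpos
  split_ifs with hs
  · have hN0 : N sstar = 0 := by simpa [hs] using hN.smul 0 (0 : E n)
    have hzero : √((⟪g + H sstar, u⟫ + σ * N sstar ^ 2 / 2) * (σ / 6)) = 0 :=
      Real.sqrt_eq_zero_of_nonpos
        (mul_nonpos_of_nonpos_of_nonneg (by rw [hN0]; linarith) (by positivity))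
    rw [hzero] at hbound
    linarith
  · have hr : 0 < N sstar := (hN.nonneg sstar).lt_of_ne fun h => hs (hN.eq_zero _ h.symm)
    set r := N sstar
    set ψ := 1 + 2 * ⟪g + H sstar, u⟫ / (σ * r ^ 2) with hψ
    have hprod : (⟪g + H sstar, u⟫ + σ * r ^ 2 / 2) * (σ / 6) = (σ * r / 2) ^ 2 * (ψ / 3) := by
      rw [hψ]
      field_simp
      ring
    have hsqrt : √(max 0 ψ) = √ψ := by
      rcases le_total 0 ψ with h | h
      · rw [max_eq_right h]
      · rw [max_eq_left h, Real.sqrt_zero, Real.sqrt_eq_zero_of_nonpos h]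
    rw [hprod, Real.sqrt_mul (sq_nonneg _), Real.sqrt_sq (by positivity),
      Real.sqrt_div' _ (by norm_num)] at hbound
    rw [hsqrt]
    have hring : 2 / √3 * √ψ * (σ * r) = 4 * (σ * r / 2 * (√ψ / √3)) := by ring
    linarith
end
end

section
/- Let s ∈ ℝ^n satisfy m(s) ≤ m(0) and ‖g_s‖_{N,1} < (1/2) σ N(s)², where g_s := g + Hs. Then there exists α ∈ (0,1] such that m(s) − m((1−α) s) ≥ (1/2) · min[ ( (1/2)σN(s)² − ‖g_s‖_{N,1} )² / (1 + (3/2)(‖H‖_{N,2} + σ N(s))), ( (1/2)σN(s)² − ‖g_s‖_{N,1} )^{3/2} / (3√σ) ]. -/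
open scoped RealInnerProductSpace

noncomputable section

/-- A linear map out of a finite-dimensional space is bounded with respect to any norm on it. -/
lemma exists_norm_le_mul_of_normCore {V W : Type*} [AddCommGroup V] [Module ℝ V]
    [FiniteDimensional ℝ V] [NormedAddCommGroup W] [NormedSpace ℝ W] (p : V → ℝ)
    (hadd : ∀ x y, p (x + y) ≤ p x + p y) (hsmul : ∀ (c : ℝ) x, p (c • x) = |c| * p x)
    (hzero : ∀ x, p x = 0 → x = 0) (f : V →ₗ[ℝ] W) :
    ∃ C : ℝ, 0 ≤ C ∧ ∀ x, ‖f x‖ ≤ C * p x := by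
  have hp0 : p 0 = 0 := by simpa using hsmul 0 0
  have hneg (x : V) : p (-x) = p x := by simpa using hsmul (-1) x
  let _ : NormedAddCommGroup V := AddGroupNorm.toNormedAddCommGroup
    { toFun := p
      map_zero' := hp0
      add_le' := hadd
      neg' := hneg
      eq_zero_of_map_eq_zero' := hzero }
  let _ : NormedSpace ℝ V := { norm_smul_le := fun c x => (hsmul c x).le }
  exact ⟨‖LinearMap.toContinuousLinearMap f‖, norm_nonneg _,
    fun x => (LinearMap.toContinuousLinearMap f).le_opNorm x⟩

namespace IsNorm

variable {n : ℕ} {N : E n → ℝ}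

lemma exists_norm_le (hN : IsNorm n N) : ∃ C : ℝ, 0 ≤ C ∧ ∀ x, ‖x‖ ≤ C * N x :=
  exists_norm_le_mul_of_normCore N hN.add_le hN.smul hN.eq_zero LinearMap.id

lemma map_zero (hN : IsNorm n N) : N 0 = 0 := by simpa using hN.smul 0 0

lemma nonneg_s15 (hN : IsNorm n N) (x : E n) : 0 ≤ N x := by
  have h := hN.add_le x (-x)
  have hneg : N (-x) = N x := by simpa using hN.smul (-1) x
  rw [add_neg_cancel, hN.map_zero, hneg] at h
  linarith

lemma map_inv_smul_self (hN : IsNorm n N) {x : E n} (hx : 0 < N x) : N ((N x)⁻¹ • x) = 1 := by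
  rw [hN.smul, abs_of_pos (inv_pos.2 hx), inv_mul_cancel₀ hx.ne']

lemma abs_inner_le_dualNorm (hN : IsNorm n N) (v : E n) {s : E n} (hs : N s = 1) :
    |⟪v, s⟫| ≤ dualNorm n N v := by
  obtain ⟨C, -, hC⟩ := hN.exists_norm_le
  have hbdd : BddAbove {t : ℝ | ∃ s, N s = 1 ∧ t = ⟪v, s⟫} := by
    refine ⟨‖v‖ * C, ?_⟩
    rintro _ ⟨x, hx, rfl⟩
    have hxC := hC x
    rw [hx, mul_one] at hxC
    exact (real_inner_le_norm v x).trans (by gcongr)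
  refine abs_le'.2 ⟨le_csSup hbdd ⟨s, hs, rfl⟩, le_csSup hbdd ⟨-s, ?_, (inner_neg_right v s).symm⟩⟩
  simpa [hs] using hN.smul (-1) s

lemma abs_inner_le_dualNorm_mul (hN : IsNorm n N) (v : E n) {s : E n} (hs : 0 < N s) :
    |⟪v, s⟫| ≤ dualNorm n N v * N s := by
  have h := hN.abs_inner_le_dualNorm v (hN.map_inv_smul_self hs)
  rwa [inner_smul_right, abs_mul, abs_of_pos (inv_pos.2 hs), inv_mul_le_iff₀ hs, mul_comm] at h

lemma dualNorm_nonneg (hN : IsNorm n N) (v : E n) : 0 ≤ dualNorm n N v := by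
  rcases Set.eq_empty_or_nonempty {s | N s = 1} with h | ⟨s, hs⟩
  · have : {t : ℝ | ∃ s, N s = 1 ∧ t = ⟪v, s⟫} = ∅ :=
      Set.eq_empty_of_forall_notMem fun _ ⟨s, hs, _⟩ => (h ▸ hs : s ∈ (∅ : Set (E n)))
    rw [dualNorm, this, Real.sSup_empty]
  · exact (abs_nonneg _).trans (hN.abs_inner_le_dualNorm v hs)

lemma abs_inner_le_matNormN_mul_sq (hN : IsNorm n N) (A : E n →L[ℝ] E n) {s : E n}
    (hs : 0 < N s) : |⟪A s, s⟫| ≤ matNormN n N A * N s ^ 2 := by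
  obtain ⟨C, hC0, hC⟩ := hN.exists_norm_le
  have hbdd : BddAbove {t : ℝ | ∃ v : E n, N v = 1 ∧ t = |⟪A v, v⟫|} := by
    refine ⟨‖A‖ * C * C, ?_⟩
    rintro _ ⟨x, hx, rfl⟩
    have hxC := hC x
    rw [hx, mul_one] at hxC
    refine (abs_real_inner_le_norm _ _).trans ?_
    have := (A.le_opNorm x).trans (mul_le_mul_of_nonneg_left hxC (norm_nonneg A))
    gcongr
  have h : |⟪A ((N s)⁻¹ • s), (N s)⁻¹ • s⟫| ≤ matNormN n N A :=
    le_csSup hbdd ⟨_, hN.map_inv_smul_self hs, rfl⟩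
  rw [map_smul, inner_smul_left, inner_smul_right, abs_mul, abs_mul] at h
  simp only [conj_trivial, abs_of_pos (inv_pos.2 hs)] at h
  rwa [inv_mul_le_iff₀ hs, inv_mul_le_iff₀ hs, ← mul_assoc, ← sq, mul_comm] at h

end IsNorm

lemma matNormN_nonneg {n : ℕ} (N : E n → ℝ) (A : E n →L[ℝ] E n) : 0 ≤ matNormN n N A :=
  Real.sSup_nonneg (by rintro _ ⟨v, -, rfl⟩; exact abs_nonneg _)

lemma qm_sub_qm_one_sub_smul {n : ℕ} {N : E n → ℝ} (hN : IsNorm n N) (f0 : ℝ) (g : E n)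
    (H : E n →L[ℝ] E n) (σ : ℝ) (s : E n) {α : ℝ} (hα : α ≤ 1) :
    qm n N f0 g H σ s - qm n N f0 g H σ ((1 - α) • s) =
      α * ⟪g + H s, s⟫ - α ^ 2 / 2 * ⟪H s, s⟫ +
        σ / 6 * N s ^ 3 * (3 * α - 3 * α ^ 2 + α ^ 3) := by
  simp only [qm, hN.smul, abs_of_nonneg (sub_nonneg.2 hα), map_smul, inner_smul_left,
    inner_smul_right, inner_add_left, conj_trivial]
  ring

/-- retraction-step decrease: if `m(s) ≤ m(0)` and
`‖g+Hs‖_{N,1} < (1/2)σN(s)²`, then some `α ∈ (0,1]` gives the stated model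
decrease when moving back from `s` towards the origin. -/
theorem stmt15 {n : ℕ} (hn : 1 ≤ n) (N : E n → ℝ) (hN : IsNorm n N)
    (f0 : ℝ) (g : E n) (H : E n →L[ℝ] E n)
    (hH : ∀ x y : E n, ⟪H x, y⟫ = ⟪x, H y⟫)
    (σ : ℝ) (hσ : 0 < σ) (s : E n)
    (hdesc : qm n N f0 g H σ s ≤ qm n N f0 g H σ 0)
    (hsmall : dualNorm n N (g + H s) < (1 / 2) * σ * N s ^ 2) :
    ∃ α : ℝ, 0 < α ∧ α ≤ 1 ∧
      qm n N f0 g H σ s - qm n N f0 g H σ ((1 - α) • s) ≥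
        (1 / 2) *
          min (((1 / 2) * σ * N s ^ 2 - dualNorm n N (g + H s)) ^ 2 /
              (1 + (3 / 2) * (matNormN n N H + σ * N s)))
            (((1 / 2) * σ * N s ^ 2 - dualNorm n N (g + H s)) ^ ((3 : ℝ) / 2) /
              (3 * Real.sqrt σ)) := by
  have hr : 0 < N s := by
    refine (hN.nonneg_s15 s).lt_of_ne fun h => ?_
    rw [← h] at hsmall
    linarith [hN.dualNorm_nonneg (g + H s)]
  have hD := hN.dualNorm_nonneg (g + H s)
  have hM := matNormN_nonneg N H
  have hgs := (abs_le.1 (hN.abs_inner_le_dualNorm_mul (g + H s) hr)).1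
  have hHs := (abs_le.1 (hN.abs_inner_le_matNormN_mul_sq H hr)).2
  have hqm := fun α : ℝ => qm_sub_qm_one_sub_smul hN f0 g H σ s (α := α)
  set r := N s
  set D := dualNorm n N (g + H s)
  set M := matNormN n N H
  set δ := 1 / 2 * σ * r ^ 2 - D with hδ
  have hδ0 : 0 < δ := sub_pos.2 hsmall
  set K := M + σ * r with hK
  have hK0 : 0 < K := by positivity
  have hα0 : 0 < δ / (K * r) := by positivity
  have hα1 : δ / (K * r) ≤ 1 := by
    rw [div_le_one (by positivity)]
    nlinarith [mul_nonneg hM hr.le, mul_pos hσ (pow_pos hr 2)]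
  refine ⟨δ / (K * r), hα0, hα1, ?_⟩
  rw [hqm _ hα1]
  have hval : δ / (K * r) * δ * r - (δ / (K * r)) ^ 2 / 2 * (K * r ^ 2) = 1 / 2 * (δ ^ 2 / K) := by
    field_simp
    ring
  set α := δ / (K * r)
  have hcubic : 0 ≤ σ / 6 * r ^ 3 * α ^ 3 := by positivity
  have hlin := mul_le_mul_of_nonneg_left hgs hα0.le
  have hquad := mul_le_mul_of_nonneg_left hHs (by positivity : 0 ≤ α ^ 2 / 2)
  calc _ ≥ α * δ * r - α ^ 2 / 2 * (K * r ^ 2) := by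
        rw [hδ, hK]
        linarith
    _ = 1 / 2 * (δ ^ 2 / K) := hval
    _ ≥ 1 / 2 * (δ ^ 2 / (1 + 3 / 2 * K)) := by
        gcongr
        linarith
    _ ≥ _ := by
        gcongr
        exact min_le_left _ _
end
end
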